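/- Let α ≥ 1 and let S be a nonempty finite set of elementary cubes in (ℤ/Lℤ)^D. If S is sparse at level p, then the partition of S into clusters witnessing level-p sparsity is unique: any two partitions of S into disjoint clusters, each cluster of diameter at most ξ(p) and the union of any two distinct clusters of diameter greater than ξ(p+1), coincide. -/

import Mathlib

open Finset

namespace BH

/-- The lattice `Λ = (ℤ/Lℤ)^D`. -/
abbrev Site (L D : ℕ) := Fin D → ZMod L

/-- Distance on the cyclic group `ℤ/Lℤ` (periodic boundary conditions). -/
def cDist {L : ℕ} (a b : ZMod L) : ℕ := min (a - b).val (b - a).val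

/-- The `l_∞` distance on the lattice `(ℤ/Lℤ)^D`. -/
def dist' {L D : ℕ} (u v : Site L D) : ℕ :=
  Finset.univ.sup fun i => cDist (u i) (v i)

/-- `l_∞` diameter of a finite set of sites. -/
def fdiam {L D : ℕ} (X : Finset (Site L D)) : ℕ :=
  X.sup fun u => X.sup fun v => dist' u v

/-- The elementary cube with corner `c` (a translate of `{0,1}^D`, of `l_∞`
diameter 1). -/
def elemCube {L D : ℕ} [NeZero L] (c : Site L D) : Finset (Site L D) :=
  Finset.univ.filter fun v => ∀ i, (v i - c i).val ≤ 1

/-- The level-`p` unit of length `ξ(p) = (10α)^p`. -/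
def ξ (α : ℝ) (p : ℕ) : ℝ := (10 * α) ^ p

/-- The `l_∞` diameter of a finite set of elementary cubes, each cube given by
its corner. -/
def cubesDiam {L D : ℕ} [NeZero L] (S : Finset (Site L D)) : ℕ :=
  fdiam (S.biUnion elemCube)

/-- `P` is a partition of the set `S` of elementary cubes into disjoint clusters,
each of diameter at most `ξ(p)`, such that the union of any two distinct
clusters has diameter greater than `ξ(p+1)`. -/
def clusterPartition {L D : ℕ} [NeZero L] (α : ℝ) (p : ℕ)
    (S : Finset (Site L D)) (P : Finset (Finset (Site L D))) : Prop :=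
  (∀ C ∈ P, C.Nonempty) ∧
  (∀ C ∈ P, C ⊆ S) ∧
  (∀ x ∈ S, ∃! C, C ∈ P ∧ x ∈ C) ∧
  (∀ C ∈ P, (cubesDiam C : ℝ) ≤ ξ α p) ∧
  (∀ C ∈ P, ∀ C' ∈ P, C ≠ C' → ξ α (p + 1) < (cubesDiam (C ∪ C') : ℝ))

/-- A nonempty finite set of elementary cubes is sparse at level `p` iff it
admits a level-`p` cluster partition; otherwise it is dense at level `p`. -/
def sparseAt {L D : ℕ} [NeZero L] (α : ℝ) (p : ℕ) (S : Finset (Site L D)) : Prop :=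
  ∃ P, clusterPartition α p S P

/-- A nonempty set of elementary cubes that is not sparse at level `p` is dense
at level `p`. -/
def denseAt {L D : ℕ} [NeZero L] (α : ℝ) (p : ℕ) (S : Finset (Site L D)) : Prop :=
  S.Nonempty ∧ ¬ sparseAt α p S

end BH

namespace BH

theorem cDist_triangle {L : ℕ} [NeZero L] (a b c : ZMod L) :
    cDist a c ≤ cDist a b + cDist b c := by
  have key : ∀ x y : ZMod L, min (x + y).val (-(x + y)).val ≤
      min x.val (-x).val + min y.val (-y).val := by
    intro x y
    have hx := ZMod.val_lt x
    have hy := ZMod.val_lt y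
    have hs := ZMod.val_add x y
    have hsn : (-(x+y)).val = if x + y = 0 then 0 else L - (x+y).val := ZMod.neg_val _
    have hxn : (-x).val = if x = 0 then 0 else L - x.val := ZMod.neg_val _
    have hyn : (-y).val = if y = 0 then 0 else L - y.val := ZMod.neg_val _
    have zx := ZMod.val_eq_zero x
    have zy := ZMod.val_eq_zero y
    have zs := ZMod.val_eq_zero (x + y)
    have hmod : (x.val + y.val) % L = x.val + y.val ∨
        (x.val + y.val) % L + L = x.val + y.val := by
      rcases lt_or_ge (x.val + y.val) L with h | h
      · left; exact Nat.mod_eq_of_lt h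
      · right
        rw [Nat.mod_eq_sub_mod h, Nat.mod_eq_of_lt (by omega)]
        omega
    rw [← hs] at hmod
    have hsl := ZMod.val_lt (x + y)
    clear hs
    rw [hsn, hxn, hyn]
    simp only [← zx, ← zy, ← zs]
    generalize (x + y).val = s at *
    generalize x.val = a at *
    generalize y.val = b at *
    clear hsn hxn hyn zx zy zs
    split_ifs <;> omega
  have := key (a - b) (b - c)
  simpa [cDist] using this

theorem dist'_triangle {L D : ℕ} [NeZero L] (u v w : Site L D) :
    dist' u w ≤ dist' u v + dist' v w := by
  refine Finset.sup_le fun i hi => (cDist_triangle (u i) (v i) (w i)).trans ?_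
  exact add_le_add (Finset.le_sup (f := fun i => cDist (u i) (v i)) hi)
    (Finset.le_sup (f := fun i => cDist (v i) (w i)) hi)

theorem dist'_le_fdiam {L D : ℕ} {X : Finset (Site L D)} {u v : Site L D}
    (hu : u ∈ X) (hv : v ∈ X) : dist' u v ≤ fdiam X :=
  (Finset.le_sup (f := fun v => dist' u v) hv).trans
    (Finset.le_sup (f := fun u => X.sup fun v => dist' u v) hu)

theorem corner_mem {L D : ℕ} [NeZero L] {C : Finset (Site L D)} {x : Site L D}
    (hx : x ∈ C) : x ∈ C.biUnion elemCube :=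
  Finset.mem_biUnion.2 ⟨x, hx, by simp [elemCube]⟩

theorem cubesDiam_union_le {L D : ℕ} [NeZero L] {A B C : Finset (Site L D)} {x y : Site L D}
    (hxA : x ∈ A) (hyB : y ∈ B) (hx : x ∈ C) (hy : y ∈ C) :
    cubesDiam (A ∪ B) ≤ cubesDiam A + cubesDiam C + cubesDiam B := by
  refine Finset.sup_le fun u hu => Finset.sup_le fun v hv => ?_
  rw [Finset.union_biUnion, Finset.mem_union] at hu hv
  have hxy : dist' x y ≤ cubesDiam C := dist'_le_fdiam (corner_mem hx) (corner_mem hy)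
  have hyx : dist' y x ≤ cubesDiam C := dist'_le_fdiam (corner_mem hy) (corner_mem hx)
  rcases hu with hu | hu <;> rcases hv with hv | hv
  · have : dist' u v ≤ cubesDiam A := dist'_le_fdiam hu hv
    omega
  · have h1 : dist' u x ≤ cubesDiam A := dist'_le_fdiam hu (corner_mem hxA)
    have h2 : dist' y v ≤ cubesDiam B := dist'_le_fdiam (corner_mem hyB) hv
    have h3 := dist'_triangle u x v
    have h4 := dist'_triangle x y v
    omega
  · have h1 : dist' x v ≤ cubesDiam A := dist'_le_fdiam (corner_mem hxA) hv
    have h2 : dist' u y ≤ cubesDiam B := dist'_le_fdiam hu (corner_mem hyB)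
    have h3 := dist'_triangle u y v
    have h4 := dist'_triangle y x v
    omega
  · have : dist' u v ≤ cubesDiam B := dist'_le_fdiam hu hv
    omega

theorem cluster_subset {L D : ℕ} [NeZero L] {α : ℝ} (hα : 1 ≤ α) {p : ℕ}
    {S : Finset (Site L D)} {P₁ P₂ : Finset (Finset (Site L D))}
    (h₁ : clusterPartition α p S P₁) (h₂ : clusterPartition α p S P₂)
    {C A : Finset (Site L D)} {x : Site L D} (hC : C ∈ P₁) (hA : A ∈ P₂)
    (hxC : x ∈ C) (hxA : x ∈ A) : C ⊆ A := by
  intro y hy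
  obtain ⟨B, ⟨hB, hyB⟩, -⟩ := h₂.2.2.1 y (h₁.2.1 C hC hy)
  by_cases hAB : A = B
  · rwa [hAB]
  exfalso
  have a1 := h₂.2.2.2.2 A hA B hB hAB
  have a2 : (cubesDiam (A ∪ B) : ℝ) ≤ cubesDiam A + cubesDiam C + cubesDiam B := by
    exact_mod_cast cubesDiam_union_le hxA hyB hxC hy
  have a3 := h₂.2.2.2.1 A hA
  have a4 := h₂.2.2.2.1 B hB
  have a5 := h₁.2.2.2.1 C hC
  have a6 : 0 < ξ α p := by unfold ξ; positivity
  have a7 : ξ α (p + 1) = ξ α p * (10 * α) := pow_succ _ _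
  nlinarith

theorem partition_subset {L D : ℕ} [NeZero L] {α : ℝ} (hα : 1 ≤ α) {p : ℕ}
    {S : Finset (Site L D)} {P₁ P₂ : Finset (Finset (Site L D))}
    (h₁ : clusterPartition α p S P₁) (h₂ : clusterPartition α p S P₂) : P₁ ⊆ P₂ := by
  intro C hC
  obtain ⟨x, hx⟩ := h₁.1 C hC
  obtain ⟨A, ⟨hA, hxA⟩, -⟩ := h₂.2.2.1 x (h₁.2.1 C hC hx)
  have : C = A := (cluster_subset hα h₁ h₂ hC hA hx hxA).antisymm
    (cluster_subset hα h₂ h₁ hA hC hxA hx)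
  rwa [this]

/-- Let `α ≥ 1` and let `S` be a nonempty finite set of
elementary cubes in `(ℤ/Lℤ)^D` that is sparse at level `p`. Then the partition
of `S` into clusters witnessing level-`p` sparsity is unique: any two
partitions of `S` into disjoint clusters, each cluster of diameter at most
`ξ(p)` and the union of any two distinct clusters of diameter greater than
`ξ(p+1)`, coincide. -/
theorem sparse_partition_unique (L D : ℕ) [NeZero L] (α : ℝ) (hα : 1 ≤ α)
    (S : Finset (Site L D)) (hS : S.Nonempty) (p : ℕ)
    (hsparse : sparseAt α p S)
    (P₁ P₂ : Finset (Finset (Site L D)))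
    (h₁ : clusterPartition α p S P₁) (h₂ : clusterPartition α p S P₂) :
    P₁ = P₂ := by
  exact (partition_subset hα h₁ h₂).antisymm (partition_subset hα h₂ h₁)

end BH
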